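/- Consider 3 qubits with sites {1,2,3} and singlet projectors H_{12}, H_{23}, H_{13}. For a real parameter α ≤ 1 and either choice of sign ε ∈ {+1, −1}, the sum-of-squares matrix identity holds: (3/2)·I − (H_{12} + H_{23} + α·H_{13}) = (3/2)·(I − (2/3)·H_{12} − (2/3)·H_{23} − ((2 + ε·√(6(1−α)))/3)·H_{13})². In particular λ_max(H_{12} + H_{23} + α·H_{13}) ≤ 3/2 for all α ≤ 1. -/

import Mathlib

open Matrix Finset
open scoped ComplexOrder

noncomputable section

/-- The SWAP matrix on qubits indexed by `V`, exchanging tensor factors `i` and `j`. -/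
def swapMat {V : Type*} [Fintype V] [DecidableEq V] (i j : V) :
    Matrix (V → Fin 2) (V → Fin 2) ℂ :=
  Matrix.of fun f g => if f ∘ (Equiv.swap i j) = g then 1 else 0

/-- The singlet projector `H_{ij} = (I - P_{ij})/2`. -/
def singletProj {V : Type*} [Fintype V] [DecidableEq V] (i j : V) :
    Matrix (V → Fin 2) (V → Fin 2) ℂ :=
  (2 : ℂ)⁻¹ • (1 - swapMat i j)

theorem swapMat_mul_apply {V : Type*} [Fintype V] [DecidableEq V] (i j k l : V)
    (f g : V → Fin 2) :
    (swapMat i j * swapMat k l) f g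
      = if (f ∘ Equiv.swap i j) ∘ Equiv.swap k l = g then 1 else 0 := by
  simp only [swapMat, Matrix.mul_apply, Matrix.of_apply, ite_mul, one_mul, zero_mul,
    Finset.sum_ite_eq, Finset.mem_univ, if_true]

theorem swapMat_mul_self {V : Type*} [Fintype V] [DecidableEq V] (i j : V) :
    swapMat i j * swapMat i j = 1 := by
  ext f g
  have h : (f ∘ Equiv.swap i j) ∘ Equiv.swap i j = f := by
    ext x
    simp
  rw [swapMat_mul_apply, h, Matrix.one_apply]

theorem swapMat_isHermitian {V : Type*} [Fintype V] [DecidableEq V] (i j : V) :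
    (swapMat i j).IsHermitian := by
  ext f g
  have h : g ∘ Equiv.swap i j = f ↔ f ∘ Equiv.swap i j = g := by
    constructor <;> rintro rfl <;> ext x <;> simp
  simp only [swapMat, Matrix.conjTranspose_apply, Matrix.of_apply, h]
  split_ifs <;> simp

theorem singletProj_mul_self {V : Type*} [Fintype V] [DecidableEq V] (i j : V) :
    singletProj i j * singletProj i j = singletProj i j := by
  simp only [singletProj, smul_mul_smul_comm, sub_mul, mul_sub, one_mul, mul_one,
    swapMat_mul_self]
  module

theorem singletProj_isHermitian {V : Type*} [Fintype V] [DecidableEq V] (i j : V) :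
    (singletProj i j).IsHermitian := by
  have h := (swapMat_isHermitian i j).eq
  simp [singletProj, Matrix.IsHermitian, h]

/-- Anticommutator of two overlapping swaps, from the vanishing of the antisymmetrizer on three
qubits. -/
theorem swapMat_anticomm {i j k : Fin 3} (hij : i ≠ j) (hik : i ≠ k) (hjk : j ≠ k) :
    swapMat i j * swapMat j k + swapMat j k * swapMat i j
      = swapMat i j + swapMat j k + swapMat i k - 1 := by
  have key : ∀ i j k : Fin 3, i ≠ j → i ≠ k → j ≠ k → ∀ f g : Fin 3 → Fin 2,
      (if (f ∘ Equiv.swap i j) ∘ Equiv.swap j k = g then 1 else 0 : ℤ)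
        + (if (f ∘ Equiv.swap j k) ∘ Equiv.swap i j = g then 1 else 0)
      = (if f ∘ Equiv.swap i j = g then 1 else 0) + (if f ∘ Equiv.swap j k = g then 1 else 0)
        + (if f ∘ Equiv.swap i k = g then 1 else 0) - (if f = g then 1 else 0) := by
    decide +kernel
  ext f g
  simp only [Matrix.add_apply, Matrix.sub_apply, swapMat_mul_apply, Matrix.one_apply]
  simp only [swapMat, Matrix.of_apply]
  exact_mod_cast congrArg (Int.cast : ℤ → ℂ) (key i j k hij hik hjk f g)

theorem singletProj_anticomm {i j k : Fin 3} (hij : i ≠ j) (hik : i ≠ k) (hjk : j ≠ k) :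
    singletProj j k * singletProj i j
      = (2 : ℂ)⁻¹ • (singletProj i j + singletProj j k - singletProj i k)
        - singletProj i j * singletProj j k := by
  have h := eq_sub_of_add_eq' (swapMat_anticomm hij hik hjk)
  simp only [singletProj, smul_mul_smul_comm, sub_mul, mul_sub, one_mul, mul_one, h]
  module

theorem singletProj_comm {V : Type*} [Fintype V] [DecidableEq V] (i j : V) :
    singletProj i j = singletProj j i := by
  simp only [singletProj, swapMat, Equiv.swap_comm i j]

theorem eigenvalues_le_of_posSemidef {n : Type*} [Fintype n] [DecidableEq n]
    {A : Matrix n n ℂ} (hA : A.IsHermitian) {c : ℝ}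
    (h : ((c : ℂ) • (1 : Matrix n n ℂ) - A).PosSemidef) (y : n) :
    hA.eigenvalues y ≤ c := by
  have h1 := h.dotProduct_mulVec_nonneg (hA.eigenvectorBasis y).ofLp
  have h2 : star (hA.eigenvectorBasis y).ofLp ⬝ᵥ (hA.eigenvectorBasis y).ofLp = (1 : ℂ) := by
    have := hA.eigenvectorBasis.orthonormal.1 y
    have h3 := inner_self_eq_norm_sq_to_K (𝕜 := ℂ) (hA.eigenvectorBasis y)
    rw [this, EuclideanSpace.inner_eq_star_dotProduct, dotProduct_comm] at h3
    simpa using h3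
  rw [Matrix.sub_mulVec, Matrix.smul_mulVec, Matrix.one_mulVec, hA.mulVec_eigenvectorBasis,
    dotProduct_sub, dotProduct_smul, dotProduct_smul, h2] at h1
  have h4 := (Complex.le_def.1 h1).1
  simpa using h4

/-- Level-1 sum-of-squares identity for the triangle with weights `(1, 1, α)`, `α ≤ 1`,
for either choice of sign `ε ∈ {+1, −1}`; in particular
`λ_max(H₁₂ + H₂₃ + α·H₁₃) ≤ 3/2`. -/
theorem stmt12 (α : ℝ) (hα : α ≤ 1) (ε : ℝ) (hε : ε = 1 ∨ ε = -1)
    (hH : ((singletProj (0 : Fin 3) 1 + singletProj (1 : Fin 3) 2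
      + (α : ℂ) • singletProj (0 : Fin 3) 2)).IsHermitian) :
    (((3/2 : ℝ) : ℂ) • (1 : Matrix (Fin 3 → Fin 2) (Fin 3 → Fin 2) ℂ)
        - (singletProj (0 : Fin 3) 1 + singletProj (1 : Fin 3) 2
            + (α : ℂ) • singletProj (0 : Fin 3) 2)
      = ((3/2 : ℝ) : ℂ) •
          ((1 : Matrix (Fin 3 → Fin 2) (Fin 3 → Fin 2) ℂ)
            - ((2/3 : ℝ) : ℂ) • singletProj (0 : Fin 3) 1
            - ((2/3 : ℝ) : ℂ) • singletProj (1 : Fin 3) 2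
            - (((2 + ε * Real.sqrt (6 * (1 - α))) / 3 : ℝ) : ℂ)
                • singletProj (0 : Fin 3) 2) ^ 2) ∧
    (⨆ y, hH.eigenvalues y) ≤ 3/2 := by
  have hsq : (((3/2 : ℝ) : ℂ) • (1 : Matrix (Fin 3 → Fin 2) (Fin 3 → Fin 2) ℂ)
        - (singletProj (0 : Fin 3) 1 + singletProj (1 : Fin 3) 2
            + (α : ℂ) • singletProj (0 : Fin 3) 2)
      = ((3/2 : ℝ) : ℂ) •
          ((1 : Matrix (Fin 3 → Fin 2) (Fin 3 → Fin 2) ℂ)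
            - ((2/3 : ℝ) : ℂ) • singletProj (0 : Fin 3) 1
            - ((2/3 : ℝ) : ℂ) • singletProj (1 : Fin 3) 2
            - (((2 + ε * Real.sqrt (6 * (1 - α))) / 3 : ℝ) : ℂ)
                • singletProj (0 : Fin 3) 2) ^ 2) := by
    have hs : (ε * Real.sqrt (6 * (1 - α))) ^ 2 = 6 * (1 - α) := by
      have hε2 : ε ^ 2 = 1 := by rcases hε with rfl | rfl <;> norm_num
      rw [mul_pow, hε2, Real.sq_sqrt (by linarith), one_mul]
    generalize ε * Real.sqrt (6 * (1 - α)) = s at hs ⊢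
    obtain rfl : α = 1 - s ^ 2 / 6 := by linarith
    have h01 := singletProj_anticomm (i := 0) (j := 1) (k := 2) (by decide) (by decide) (by decide)
    have h12 := singletProj_anticomm (i := 0) (j := 2) (k := 1) (by decide) (by decide) (by decide)
    have h02 := singletProj_anticomm (i := 1) (j := 0) (k := 2) (by decide) (by decide) (by decide)
    rw [singletProj_comm 2 1] at h12
    rw [singletProj_comm 1 0] at h02
    simp only [pow_two, sub_mul, mul_sub, one_mul, mul_one, smul_mul_assoc,
      mul_smul_comm, singletProj_mul_self, h01, h12, h02]
    push_cast
    module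
  refine ⟨hsq, ciSup_le fun y => eigenvalues_le_of_posSemidef hH ?_ y⟩
  rw [hsq]
  refine Matrix.PosSemidef.smul ?_ (by
    rw [Complex.zero_le_real]
    norm_num)
  have hB : ∀ a b c : ℝ, ((1 : Matrix (Fin 3 → Fin 2) (Fin 3 → Fin 2) ℂ)
      - (a : ℂ) • singletProj (0 : Fin 3) 1 - (b : ℂ) • singletProj (1 : Fin 3) 2
      - (c : ℂ) • singletProj (0 : Fin 3) 2).IsHermitian := by
    intro a b c
    simp [Matrix.IsHermitian, (singletProj_isHermitian _ _).eq]
  have h := Matrix.posSemidef_conjTranspose_mul_self ((1 : Matrix (Fin 3 → Fin 2) (Fin 3 → Fin 2) ℂ)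
      - ((2/3 : ℝ) : ℂ) • singletProj (0 : Fin 3) 1
      - ((2/3 : ℝ) : ℂ) • singletProj (1 : Fin 3) 2
      - (((2 + ε * Real.sqrt (6 * (1 - α))) / 3 : ℝ) : ℂ) • singletProj (0 : Fin 3) 2)
  rwa [(hB _ _ _).eq, ← pow_two] at h

end
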